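/- For every integer m ≥ 1 there exists a constant c > 0 depending only on m with the following property: for all D ≥ 1, all M > 0, all σ ∈ (0,1] with D·σ² ≤ 1, every f as in the context, and a random vector θ ∈ ℝ^D whose coordinates are independent and uniformly distributed on [−σ, σ], the mean-squared Taylor truncation error satisfies E[ (f(θ) − T_m f(θ))² ] ≤ c·M²·D^m·σ^{2m}. -/

import Mathlib

open MeasureTheory

/-- The partial derivative `∂_{θ_k} f`. -/
noncomputable def partialDeriv {D : ℕ} (k : Fin D) (f : (Fin D → ℝ) → ℝ) :
    (Fin D → ℝ) → ℝ :=
  fun θ => fderiv ℝ f θ (Pi.single k 1)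

/-- The higher-order partial derivative `D^α = ∂_{θ_1}^{α_1} ⋯ ∂_{θ_D}^{α_D}`
associated with a multi-index `α ∈ ℕ^D`. -/
noncomputable def multiDeriv {D : ℕ} (α : Fin D → ℕ) (f : (Fin D → ℝ) → ℝ) :
    (Fin D → ℝ) → ℝ :=
  ((List.finRange D).flatMap (fun k => List.replicate (α k) k)).foldr partialDeriv f

/-- The finite set of multi-indices `α ∈ ℕ^D` with `|α|₁ < m`. -/
def multiIdxBelow (D m : ℕ) : Finset (Fin D → ℕ) :=
  (Finset.range m).biUnion (fun i => Finset.Nat.antidiagonalTuple D i)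

/-- The truncated Taylor series `T_m f(θ) := Σ_{|α|₁ < m} D^α f(0) · θ^α / α!` of `f` at `0`. -/
noncomputable def taylorTrunc (D m : ℕ) (f : (Fin D → ℝ) → ℝ) (θ : Fin D → ℝ) : ℝ :=
  ∑ α ∈ multiIdxBelow D m,
    multiDeriv α f 0 * (∏ k, θ k ^ α k) / (∏ k, (Nat.factorial (α k) : ℝ))

/-- The law of a random vector `θ ∈ ℝ^D` with independent coordinates, each uniformly
distributed on `[−σ, σ]`. -/
noncomputable def uniformCubeMeasure (D : ℕ) (σ : ℝ) : Measure (Fin D → ℝ) :=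
  Measure.pi (fun _ : Fin D =>
    ENNReal.ofReal (1 / (2 * σ)) • volume.restrict (Set.Icc (-σ) σ))

theorem contDiff_partialDeriv {D : ℕ} (k : Fin D) {f : (Fin D → ℝ) → ℝ}
    (hf : ContDiff ℝ (⊤ : ℕ∞) f) : ContDiff ℝ (⊤ : ℕ∞) (partialDeriv k f) :=
  (hf.fderiv_right (by simp)).clm_apply contDiff_const

theorem partialDeriv_comm {D : ℕ} (j k : Fin D) {f : (Fin D → ℝ) → ℝ}
    (hf : ContDiff ℝ (⊤ : ℕ∞) f) :
    partialDeriv j (partialDeriv k f) = partialDeriv k (partialDeriv j f) := by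
  have hd : Differentiable ℝ (fderiv ℝ f) :=
    (hf.fderiv_right (m := (⊤ : ℕ∞)) (by simp)).differentiable (by simp)
  have key : ∀ (i l : Fin D) (x : Fin D → ℝ), partialDeriv i (partialDeriv l f) x =
      fderiv ℝ (fderiv ℝ f) x (Pi.single i 1) (Pi.single l 1) := by
    intro i l x
    have h := (hd x).hasFDerivAt.clm_apply (hasFDerivAt_const (Pi.single l (1 : ℝ)) x)
    have h2 := h.fderiv
    change fderiv ℝ (fun y => fderiv ℝ f y (Pi.single l 1)) x (Pi.single i 1) = _
    rw [h2]
    simp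
  funext x
  rw [key, key]
  exact (hf.contDiffAt.isSymmSndFDerivAt
    (by rw [minSmoothness_of_isRCLikeNormedField]; exact WithTop.coe_le_coe.2 (le_top : (2 : ℕ∞) ≤ ⊤))) _ _

theorem contDiff_foldr_partialDeriv {D : ℕ} (l : List (Fin D)) {f : (Fin D → ℝ) → ℝ}
    (hf : ContDiff ℝ (⊤ : ℕ∞) f) : ContDiff ℝ (⊤ : ℕ∞) (l.foldr partialDeriv f) := by
  induction l with
  | nil => exact hf
  | cons k l ih => exact contDiff_partialDeriv k ih

theorem foldr_partialDeriv_perm {D : ℕ} {l₁ l₂ : List (Fin D)} (h : l₁.Perm l₂)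
    {f : (Fin D → ℝ) → ℝ} (hf : ContDiff ℝ (⊤ : ℕ∞) f) :
    l₁.foldr partialDeriv f = l₂.foldr partialDeriv f := by
  induction h with
  | nil => rfl
  | cons k _ ih => simp only [List.foldr_cons, ih]
  | swap j k l =>
    simp only [List.foldr_cons]
    exact partialDeriv_comm _ _ (contDiff_foldr_partialDeriv l hf)
  | trans _ _ ih₁ ih₂ => exact ih₁.trans ih₂

theorem count_flatMap_replicate {D : ℕ} (α : Fin D → ℕ) (j : Fin D) :
    ((List.finRange D).flatMap (fun k => List.replicate (α k) k)).count j = α j := by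
  rw [List.count_flatMap, ← List.ofFn_eq_map, List.sum_ofFn]
  simp [List.count_replicate]

/-- Applying `D^α` to `∂_k f` is applying `D^(α + e_k)` to `f`. -/
theorem multiDeriv_partialDeriv {D : ℕ} (α : Fin D → ℕ) (k : Fin D) {f : (Fin D → ℝ) → ℝ}
    (hf : ContDiff ℝ (⊤ : ℕ∞) f) :
    multiDeriv α (partialDeriv k f) = multiDeriv (α + Pi.single k 1) f := by
  have h : ∀ l : List (Fin D), l.foldr partialDeriv (partialDeriv k f) =
      (l ++ [k]).foldr partialDeriv f := by simp
  unfold multiDeriv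
  rw [h]
  refine foldr_partialDeriv_perm (List.perm_iff_count.2 fun j => ?_) hf
  rw [List.count_append, count_flatMap_replicate, count_flatMap_replicate]
  by_cases hjk : j = k
  · subst hjk; simp
  · simp [hjk, Ne.symm hjk]

theorem multiDeriv_zero {D : ℕ} (f : (Fin D → ℝ) → ℝ) : multiDeriv 0 f = f := by
  have h : (List.finRange D).flatMap
      (fun k => List.replicate ((0 : Fin D → ℕ) k) k) = [] := by simp
  rw [multiDeriv, h, List.foldr_nil]

theorem mem_multiIdxBelow {D m : ℕ} {α : Fin D → ℕ} :
    α ∈ multiIdxBelow D m ↔ ∑ k, α k < m := by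
  simp [multiIdxBelow, Finset.Nat.mem_antidiagonalTuple]

/-- The normalized monomial `θ^α / α!`. -/
noncomputable def normMonomial {D : ℕ} (α : Fin D → ℕ) (θ : Fin D → ℝ) : ℝ :=
  ∏ k, (θ k ^ α k / (Nat.factorial (α k) : ℝ))

theorem taylorTrunc_eq_sum_normMonomial {D : ℕ} (m : ℕ) (f : (Fin D → ℝ) → ℝ) :
    taylorTrunc D m f =
      fun θ => ∑ α ∈ multiIdxBelow D m, multiDeriv α f 0 * normMonomial α θ := by
  funext θ
  simp only [taylorTrunc, normMonomial, Finset.prod_div_distrib, mul_div_assoc]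

theorem contDiff_normMonomial {D : ℕ} (α : Fin D → ℕ) :
    ContDiff ℝ (⊤ : ℕ∞) (normMonomial α) := by
  unfold normMonomial
  fun_prop

theorem partialDeriv_normMonomial {D : ℕ} (α : Fin D → ℕ) (k : Fin D) (θ : Fin D → ℝ) :
    partialDeriv k (normMonomial α) θ =
      (∏ j ∈ Finset.univ.erase k, (θ j ^ α j / (Nat.factorial (α j) : ℝ))) *
        (α k * θ k ^ (α k - 1) / (Nat.factorial (α k) : ℝ)) := by
  have hg : ∀ i ∈ Finset.univ, HasFDerivAt
      (fun x : Fin D → ℝ => x i ^ α i / (Nat.factorial (α i) : ℝ))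
      ((α i * θ i ^ (α i - 1) / (Nat.factorial (α i) : ℝ)) •
        ContinuousLinearMap.proj (R := ℝ) (φ := fun _ : Fin D => ℝ) i) θ := by
    intro i _
    have h1 := ((hasDerivAt_pow (α i) (θ i)).div_const (Nat.factorial (α i) : ℝ))
    exact h1.comp_hasFDerivAt (f := fun x : Fin D → ℝ => x i) θ (hasFDerivAt_apply i θ)
  have h := (HasFDerivAt.finsetProd hg).fderiv
  change fderiv ℝ (fun x : Fin D → ℝ => ∏ i, (x i ^ α i / (Nat.factorial (α i) : ℝ))) θ
    (Pi.single k 1) = _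
  rw [h]
  simp only [FunLike.coe_sum, Finset.sum_apply, FunLike.coe_smul, Pi.smul_apply,
    ContinuousLinearMap.proj_apply, smul_eq_mul]
  rw [Finset.sum_eq_single k]
  · simp
  · intro b _ hb
    simp [hb]
  · simp

theorem partialDeriv_normMonomial_of_eq_zero {D : ℕ} {α : Fin D → ℕ} {k : Fin D}
    (h : α k = 0) (θ : Fin D → ℝ) : partialDeriv k (normMonomial α) θ = 0 := by
  simp [partialDeriv_normMonomial, h]

theorem partialDeriv_normMonomial_add_single {D : ℕ} (β : Fin D → ℕ) (k : Fin D)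
    (θ : Fin D → ℝ) :
    partialDeriv k (normMonomial (β + Pi.single k 1)) θ = normMonomial β θ := by
  rw [partialDeriv_normMonomial, normMonomial,
    ← Finset.prod_erase_mul _ _ (Finset.mem_univ k)]
  congr 1
  · refine Finset.prod_congr rfl fun j hj => ?_
    simp [Finset.ne_of_mem_erase hj]
  · simp only [Pi.add_apply, Pi.single_eq_same, Nat.add_sub_cancel, Nat.factorial_succ]
    push_cast
    field_simp

theorem partialDeriv_sum {D : ℕ} {ι : Type*} (s : Finset ι) (c : ι → ℝ)
    (g : ι → (Fin D → ℝ) → ℝ) (hg : ∀ i ∈ s, Differentiable ℝ (g i)) (k : Fin D)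
    (θ : Fin D → ℝ) :
    partialDeriv k (fun x => ∑ i ∈ s, c i * g i x) θ =
      ∑ i ∈ s, c i * partialDeriv k (g i) θ := by
  have h := (HasFDerivAt.fun_sum fun i hi =>
    ((hg i hi θ).hasFDerivAt.const_mul (c i))).fderiv
  simp only [partialDeriv]
  rw [h]
  simp

theorem contDiff_taylorTrunc {D : ℕ} (m : ℕ) (f : (Fin D → ℝ) → ℝ) :
    ContDiff ℝ (⊤ : ℕ∞) (taylorTrunc D m f) := by
  rw [taylorTrunc_eq_sum_normMonomial]
  exact ContDiff.sum fun α _ => contDiff_const.mul (contDiff_normMonomial α)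

/-- Differentiating a Taylor truncation is truncating the derivative one order lower. -/
theorem partialDeriv_taylorTrunc {D : ℕ} (m : ℕ) (k : Fin D) {f : (Fin D → ℝ) → ℝ}
    (hf : ContDiff ℝ (⊤ : ℕ∞) f) :
    partialDeriv k (taylorTrunc D m f) = taylorTrunc D (m - 1) (partialDeriv k f) := by
  funext θ
  rw [taylorTrunc_eq_sum_normMonomial, taylorTrunc_eq_sum_normMonomial,
    partialDeriv_sum _ _ _ (fun α _ => (contDiff_normMonomial α).differentiable (by simp))]
  symm
  refine Finset.sum_of_injOn (fun β => β + Pi.single k 1)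
    (fun a _ b _ h => add_right_cancel h) ?_ ?_ ?_
  · intro β hβ
    rw [Finset.mem_coe, mem_multiIdxBelow] at hβ ⊢
    simp only [Pi.add_apply, Finset.sum_add_distrib, Finset.sum_pi_single', Finset.mem_univ,
      if_true]
    omega
  · intro α hα hn
    suffices h : α k = 0 by rw [partialDeriv_normMonomial_of_eq_zero h, mul_zero]
    by_contra h
    refine hn ⟨α - Pi.single k 1, ?_, ?_⟩
    · rw [mem_multiIdxBelow] at hα
      rw [Finset.mem_coe, mem_multiIdxBelow]
      have h1 : α = (α - Pi.single k 1) + Pi.single k 1 := by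
        funext j
        by_cases hj : j = k
        · subst hj; simp; omega
        · simp [hj]
      have h2 : ∑ j, α j = ∑ j, (α - Pi.single k 1 : Fin D → ℕ) j + 1 := by
        conv_lhs => rw [h1]
        simp [Finset.sum_add_distrib]
      omega
    · funext j
      by_cases hj : j = k
      · subst hj; simp; omega
      · simp [hj]
  · intro β _
    rw [multiDeriv_partialDeriv β k hf, partialDeriv_normMonomial_add_single]

theorem taylorTrunc_apply_zero {D m : ℕ} (hm : 1 ≤ m) (f : (Fin D → ℝ) → ℝ) :
    taylorTrunc D m f 0 = f 0 := by
  rw [taylorTrunc_eq_sum_normMonomial]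
  dsimp only
  rw [Finset.sum_eq_single 0]
  · simp [multiDeriv_zero, normMonomial]
  · intro α _ hα
    obtain ⟨k, hk⟩ := Function.ne_iff.1 hα
    have hk : α k ≠ 0 := hk
    rw [normMonomial, Finset.prod_eq_zero (Finset.mem_univ k) (by simp [hk]), mul_zero]
  · intro h
    exact absurd (mem_multiIdxBelow.2 (by simpa using Nat.pos_of_ne_zero (Nat.one_le_iff_ne_zero.1 hm))) h

theorem taylorTrunc_zero {D : ℕ} (f : (Fin D → ℝ) → ℝ) : taylorTrunc D 0 f = 0 := by
  funext θ
  simp [taylorTrunc, multiIdxBelow]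

/-- The Taylor remainder `f - T_m f`. -/
noncomputable def taylorRem {D : ℕ} (m : ℕ) (f : (Fin D → ℝ) → ℝ) (θ : Fin D → ℝ) : ℝ :=
  f θ - taylorTrunc D m f θ

theorem contDiff_taylorRem {D : ℕ} (m : ℕ) {f : (Fin D → ℝ) → ℝ}
    (hf : ContDiff ℝ (⊤ : ℕ∞) f) : ContDiff ℝ (⊤ : ℕ∞) (taylorRem m f) :=
  hf.sub (contDiff_taylorTrunc m f)

theorem partialDeriv_taylorRem {D : ℕ} (m : ℕ) (k : Fin D) {f : (Fin D → ℝ) → ℝ}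
    (hf : ContDiff ℝ (⊤ : ℕ∞) f) :
    partialDeriv k (taylorRem m f) = taylorRem (m - 1) (partialDeriv k f) := by
  funext θ
  rw [taylorRem, ← partialDeriv_taylorTrunc m k hf]
  have h := ((hf.differentiable (by simp) θ).hasFDerivAt.sub
    ((contDiff_taylorTrunc m f).differentiable (by simp) θ).hasFDerivAt).fderiv
  change fderiv ℝ (f - taylorTrunc D m f) θ (Pi.single k 1) = _
  rw [h]
  rfl

theorem fderiv_apply_eq_sum_partialDeriv {D : ℕ} (f : (Fin D → ℝ) → ℝ) (x v : Fin D → ℝ) :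
    fderiv ℝ f x v = ∑ k, v k * partialDeriv k f x := by
  conv_lhs => rw [pi_eq_sum_univ' v]
  simp [partialDeriv, map_sum, Pi.single]

theorem partialDeriv_mul {D : ℕ} (k : Fin D) {f g : (Fin D → ℝ) → ℝ} {x : Fin D → ℝ}
    (hf : DifferentiableAt ℝ f x) (hg : DifferentiableAt ℝ g x) :
    partialDeriv k (fun y => f y * g y) x =
      f x * partialDeriv k g x + g x * partialDeriv k f x := by
  have h := (hf.hasFDerivAt.mul hg.hasFDerivAt).fderiv
  change fderiv ℝ (f * g) x _ = _
  rw [h]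
  simp [partialDeriv]

theorem partialDeriv_comp_smul {D : ℕ} (k : Fin D) {f : (Fin D → ℝ) → ℝ}
    (hf : Differentiable ℝ f) (t : ℝ) (x : Fin D → ℝ) :
    partialDeriv k (fun y => f (t • y)) x = t * partialDeriv k f (t • x) := by
  have h := ((hf (t • x)).hasFDerivAt.comp x ((hasFDerivAt_id x).const_smul t)).fderiv
  change fderiv ℝ (f ∘ HSMul.hSMul t) x _ = _
  rw [h]
  simp [partialDeriv]

theorem partialDeriv_sq_sub_coord_sq {D : ℕ} (k : Fin D) (σ : ℝ) (x : Fin D → ℝ) :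
    partialDeriv k (fun y => σ ^ 2 - y k ^ 2) x = -(2 * x k) := by
  have h := ((hasFDerivAt_apply (𝕜 := ℝ) (F' := fun _ : Fin D => ℝ) k x).pow 2).const_sub (σ ^ 2)
  change fderiv ℝ (fun y : Fin D → ℝ => σ ^ 2 - y k ^ 2) x _ = _
  rw [h.fderiv]
  simp

theorem uniformCubeMeasure_eq_smul_restrict (D : ℕ) (σ : ℝ) :
    uniformCubeMeasure D σ = ENNReal.ofReal (1 / (2 * σ)) ^ D •
      (volume.restrict (Set.Icc (fun _ => -σ) (fun _ => σ)) : Measure (Fin D → ℝ)) := by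
  have : IsFiniteMeasure
      (ENNReal.ofReal (1 / (2 * σ)) • (volume.restrict (Set.Icc (-σ) σ) : Measure ℝ)) :=
    Measure.smul_finite _ ENNReal.ofReal_ne_top
  refine Measure.pi_eq fun s hs => ?_
  rw [← Set.pi_univ_Icc, volume_pi, Measure.restrict_pi_pi]
  simp [Measure.pi_pi, Finset.prod_mul_distrib]

theorem isProbabilityMeasure_uniformCubeMeasure (D : ℕ) {σ : ℝ} (hσ : 0 < σ) :
    IsProbabilityMeasure (uniformCubeMeasure D σ) := by
  have : IsProbabilityMeasure
      (ENNReal.ofReal (1 / (2 * σ)) • (volume.restrict (Set.Icc (-σ) σ) : Measure ℝ)) := by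
    constructor
    rw [Measure.smul_apply, Measure.restrict_apply_univ, Real.volume_Icc, smul_eq_mul,
      ← ENNReal.ofReal_mul (by positivity)]
    have : 1 / (2 * σ) * (σ - -σ) = 1 := by field_simp; ring
    rw [this, ENNReal.ofReal_one]
  unfold uniformCubeMeasure
  infer_instance

theorem integrable_uniformCubeMeasure {D : ℕ} (σ : ℝ) {h : (Fin D → ℝ) → ℝ}
    (hh : Continuous h) : Integrable h (uniformCubeMeasure D σ) := by
  rw [uniformCubeMeasure_eq_smul_restrict]
  exact (hh.continuousOn.integrableOn_compact isCompact_Icc).integrable.smul_measure (by finiteness)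

theorem ae_mem_Icc_uniformCubeMeasure (D : ℕ) (σ : ℝ) :
    ∀ᵐ θ ∂(uniformCubeMeasure D σ), θ ∈ Set.Icc (fun _ => -σ) (fun _ => σ) := by
  rw [uniformCubeMeasure_eq_smul_restrict]
  exact Measure.ae_smul_measure (ae_restrict_mem measurableSet_Icc) _

/-- A vector field tangent to the faces of the cube has divergence of mean zero. -/
theorem integral_sum_partialDeriv_eq_zero {D : ℕ} (hD : 1 ≤ D) {σ : ℝ} (hσ : 0 ≤ σ)
    (V : Fin D → (Fin D → ℝ) → ℝ) (hV : ∀ k, ContDiff ℝ (⊤ : ℕ∞) (V k))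
    (hzero : ∀ k θ, θ k = σ ∨ θ k = -σ → V k θ = 0) :
    ∫ θ, ∑ k, partialDeriv k (V k) θ ∂(uniformCubeMeasure D σ) = 0 := by
  obtain ⟨n, rfl⟩ : ∃ n, D = n + 1 := ⟨D - 1, by omega⟩
  have hcont : Continuous fun θ => ∑ k, partialDeriv k (V k) θ :=
    continuous_finsetSum _ fun k _ => (contDiff_partialDeriv k (hV k)).continuous
  have h := integral_divergence_of_hasFDerivAt_off_countable'
    (fun _ : Fin (n + 1) => -σ) (fun _ => σ) (fun _ => by linarith) V
    (fun k θ => fderiv ℝ (V k) θ) ∅ Set.countable_empty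
    (fun k => (hV k).continuous.continuousOn)
    (fun θ _ k => ((hV k).differentiable (by simp) θ).hasFDerivAt)
    (hcont.continuousOn.integrableOn_compact isCompact_Icc)
  rw [uniformCubeMeasure_eq_smul_restrict, integral_smul_measure]
  have h' : ∫ θ in Set.Icc (fun _ : Fin (n + 1) => -σ) (fun _ => σ),
      ∑ k, partialDeriv k (V k) θ = 0 := by
    refine h.trans (Finset.sum_eq_zero fun k _ => ?_)
    rw [integral_congr_ae (ae_of_all _ fun x => hzero k _ (Or.inl (by simp))),
      integral_congr_ae (ae_of_all _ fun x => hzero k _ (Or.inr (by simp)))]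
    simp
  rw [h', smul_zero]

theorem hasDerivAt_integral_sq_dilation {D : ℕ} (σ : ℝ) {g : (Fin D → ℝ) → ℝ}
    (hg : ContDiff ℝ (⊤ : ℕ∞) g) (t : ℝ) :
    HasDerivAt (fun r => ∫ θ, g (r • θ) ^ 2 ∂(uniformCubeMeasure D σ))
      (∫ θ, ∑ k, 2 * θ k * (g (t • θ) * partialDeriv k g (t • θ))
        ∂(uniformCubeMeasure D σ)) t := by
  have hgc : Continuous g := hg.continuous
  have hpc : ∀ k, Continuous (partialDeriv k g) := fun k => (contDiff_partialDeriv k hg).continuous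
  set G : ℝ → (Fin D → ℝ) → ℝ :=
    fun r θ => ∑ k, 2 * θ k * (g (r • θ) * partialDeriv k g (r • θ)) with hG
  have hGc : Continuous (fun p : ℝ × (Fin D → ℝ) => G p.1 p.2) := by
    simp only [hG]
    fun_prop
  obtain ⟨C, hC⟩ := ((isCompact_Icc (a := t - 1) (b := t + 1)).prod
    (isCompact_Icc (a := fun _ : Fin D => -σ) (b := fun _ => σ))).exists_bound_of_continuousOn
    hGc.continuousOn
  have hfin : IsFiniteMeasure (uniformCubeMeasure D σ) := by
    have h := integrable_uniformCubeMeasure (D := D) σ (continuous_const (y := (1 : ℝ)))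
    simpa [integrable_const_iff] using h
  refine (hasDerivAt_integral_of_dominated_loc_of_deriv_le (F' := G) (bound := fun _ => C)
    (Icc_mem_nhds (by linarith : t - 1 < t) (by linarith : t < t + 1))
    (Filter.Eventually.of_forall fun r => ?_) ?_ ?_ ?_ (integrable_const C) ?_).2
  · exact (by fun_prop : Continuous fun θ : Fin D → ℝ => g (r • θ) ^ 2).aestronglyMeasurable
  · exact integrable_uniformCubeMeasure σ (by fun_prop)
  · exact (by fun_prop : Continuous (G t)).aestronglyMeasurable
  · filter_upwards [ae_mem_Icc_uniformCubeMeasure D σ] with θ hθ r hr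
    exact hC (r, θ) ⟨hr, hθ⟩
  · refine ae_of_all _ fun θ r _ => ?_
    have h1 : HasDerivAt (fun r : ℝ => r • θ) θ r := by
      simpa using (hasDerivAt_id r).smul_const θ
    have h2 := (((hg.differentiable (by simp) (r • θ)).hasFDerivAt).comp_hasDerivAt r h1).pow 2
    refine h2.congr_deriv ?_
    rw [fderiv_apply_eq_sum_partialDeriv]
    simp only [hG, Finset.mul_sum, Function.comp]
    refine Finset.sum_congr rfl fun k _ => ?_
    push_cast
    ring

/-- The derivative of the dilated second moment, rewritten by integration by parts. -/
theorem integral_sum_coord_mul_eq {D : ℕ} (hD : 1 ≤ D) {σ : ℝ} (hσ : 0 ≤ σ)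
    {g : (Fin D → ℝ) → ℝ} (hg : ContDiff ℝ (⊤ : ℕ∞) g) (t : ℝ) :
    ∫ θ, ∑ k, 2 * θ k * (g (t • θ) * partialDeriv k g (t • θ)) ∂(uniformCubeMeasure D σ) =
      ∫ θ, ∑ k, (σ ^ 2 - θ k ^ 2) * (t * (partialDeriv k g (t • θ) ^ 2 +
        g (t • θ) * partialDeriv k (partialDeriv k g) (t • θ))) ∂(uniformCubeMeasure D σ) := by
  have hgc : Continuous g := hg.continuous
  have hp : ∀ k, ContDiff ℝ (⊤ : ℕ∞) (partialDeriv k g) := fun k => contDiff_partialDeriv k hg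
  have hpc : ∀ k, Continuous (partialDeriv k g) := fun k => (hp k).continuous
  have hppc : ∀ k, Continuous (partialDeriv k (partialDeriv k g)) :=
    fun k => (contDiff_partialDeriv k (hp k)).continuous
  have hw : ∀ k, ContDiff ℝ (⊤ : ℕ∞) fun x => g x * partialDeriv k g x := fun k => hg.mul (hp k)
  have hwt : ∀ k, ContDiff ℝ (⊤ : ℕ∞) fun x : Fin D → ℝ =>
      g (t • x) * partialDeriv k g (t • x) := fun k => (hw k).comp (contDiff_const_smul t)
  have hq : ∀ k, ContDiff ℝ (⊤ : ℕ∞) fun x : Fin D → ℝ => σ ^ 2 - x k ^ 2 := fun k => by fun_prop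
  have hdiv := integral_sum_partialDeriv_eq_zero hD hσ
    (fun k x => (σ ^ 2 - x k ^ 2) * (g (t • x) * partialDeriv k g (t • x)))
    (fun k => (hq k).mul (hwt k))
    (by rintro k θ (h | h) <;> simp [h])
  rw [← sub_eq_zero, ← neg_eq_zero, neg_sub, ← integral_sub
    (integrable_uniformCubeMeasure σ (by fun_prop))
    (integrable_uniformCubeMeasure σ (by fun_prop)), ← hdiv]
  refine integral_congr_ae (ae_of_all _ fun θ => ?_)
  simp only [← Finset.sum_sub_distrib]
  refine Finset.sum_congr rfl fun k _ => ?_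
  rw [partialDeriv_mul k ((hq k).differentiable (by simp) θ) ((hwt k).differentiable (by simp) θ),
    partialDeriv_sq_sub_coord_sq,
    partialDeriv_comp_smul k (f := fun x => g x * partialDeriv k g x)
      ((hw k).differentiable (by simp)),
    partialDeriv_mul k (hg.differentiable (by simp) _) ((hp k).differentiable (by simp) _)]
  ring

theorem le_of_hasDerivAt_le_half_add {F F' : ℝ → ℝ} {K : ℝ} (hK : 0 ≤ K) (h0 : F 0 = 0)
    (hF : ∀ t, HasDerivAt F (F' t) t) (hF' : ∀ t ∈ Set.Icc (0 : ℝ) 1, F' t ≤ F t / 2 + K)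
    {t : ℝ} (ht : t ∈ Set.Icc (0 : ℝ) 1) : F t ≤ 4 * K := by
  have hd : ∀ r, HasDerivAt (fun r => (F r + 2 * K) * Real.exp (-r / 2))
      (F' r * Real.exp (-r / 2) + (F r + 2 * K) * (Real.exp (-r / 2) * (-1 / 2))) r := fun r =>
    ((hF r).add_const _).mul (((hasDerivAt_id r).neg.div_const 2).exp)
  have hanti : AntitoneOn (fun r => (F r + 2 * K) * Real.exp (-r / 2)) (Set.Icc 0 1) := by
    refine antitoneOn_of_deriv_nonpos (convex_Icc 0 1)
      (fun r _ => (hd r).continuousAt.continuousWithinAt)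
      (fun r _ => (hd r).differentiableAt.differentiableWithinAt) fun r hr => ?_
    rw [(hd r).deriv]
    have h := hF' r (interior_subset hr)
    nlinarith [Real.exp_pos (-r / 2)]
  have h := hanti (Set.left_mem_Icc.2 zero_le_one) ht ht.1
  simp only [h0, neg_zero, zero_div, Real.exp_zero, zero_add, mul_one] at h
  have h3 : Real.exp (t / 2) ≤ 3 :=
    (Real.exp_le_exp.2 (by linarith [ht.2])).trans (Real.exp_one_lt_d9.le.trans (by norm_num))
  have hmul : Real.exp (-t / 2) * Real.exp (t / 2) = 1 := by
    rw [← Real.exp_add, neg_div, neg_add_cancel, Real.exp_zero]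
  have h4 : F t + 2 * K ≤ 2 * K * Real.exp (t / 2) :=
    calc F t + 2 * K = (F t + 2 * K) * Real.exp (-t / 2) * Real.exp (t / 2) := by
          rw [mul_assoc, hmul, mul_one]
      _ ≤ 2 * K * Real.exp (t / 2) := by gcongr
  nlinarith

theorem mul_sq_add_mul_le {a σ p g h d : ℝ} (ha : 0 ≤ a) (ha' : a ≤ σ ^ 2) (hd : 0 < d) :
    a * (p ^ 2 + g * h) ≤ σ ^ 2 * p ^ 2 + (g ^ 2 / (2 * d) + d * σ ^ 4 / 2 * h ^ 2) := by
  have h1 : a * p ^ 2 ≤ σ ^ 2 * p ^ 2 := by gcongr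
  have h2 : a * (g * h) ≤ σ ^ 2 * |g * h| :=
    (mul_le_mul_of_nonneg_left (le_abs_self _) ha).trans
      (mul_le_mul_of_nonneg_right ha' (abs_nonneg _))
  have h3 : σ ^ 2 * |g * h| ≤ g ^ 2 / (2 * d) + d * σ ^ 4 / 2 * h ^ 2 := by
    have key : g ^ 2 / (2 * d) + d * σ ^ 4 / 2 * h ^ 2 - σ ^ 2 * (|g| * |h|) =
        (|g| - d * σ ^ 2 * |h|) ^ 2 / (2 * d) := by
      rw [← sq_abs g, ← sq_abs h]
      field_simp
      ring
    rw [abs_mul]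
    have : 0 ≤ (|g| - d * σ ^ 2 * |h|) ^ 2 / (2 * d) := by positivity
    linarith
  linarith

/-- The growth of the dilated second moment is controlled by the first and second pure partial
derivatives. -/
theorem integral_sum_coord_mul_le {D : ℕ} (hD : 1 ≤ D) {σ : ℝ} (hσ : 0 ≤ σ)
    {g : (Fin D → ℝ) → ℝ} (hg : ContDiff ℝ (⊤ : ℕ∞) g) {t : ℝ} (ht : t ∈ Set.Icc (0 : ℝ) 1) :
    ∫ θ, ∑ k, 2 * θ k * (g (t • θ) * partialDeriv k g (t • θ)) ∂(uniformCubeMeasure D σ) ≤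
      ∑ k, (σ ^ 2 * ∫ θ, partialDeriv k g (t • θ) ^ 2 ∂(uniformCubeMeasure D σ)) +
      ((∫ θ, g (t • θ) ^ 2 ∂(uniformCubeMeasure D σ)) / 2 +
      ∑ k, D * σ ^ 4 / 2 *
        ∫ θ, partialDeriv k (partialDeriv k g) (t • θ) ^ 2 ∂(uniformCubeMeasure D σ)) := by
  have hgc : Continuous g := hg.continuous
  have hp : ∀ k, ContDiff ℝ (⊤ : ℕ∞) (partialDeriv k g) := fun k => contDiff_partialDeriv k hg
  have hpc : ∀ k, Continuous (partialDeriv k g) := fun k => (hp k).continuous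
  have hppc : ∀ k, Continuous (partialDeriv k (partialDeriv k g)) :=
    fun k => (contDiff_partialDeriv k (hp k)).continuous
  have hD0 : (0 : ℝ) < D := by exact_mod_cast hD
  rw [integral_sum_coord_mul_eq hD hσ hg]
  have hint : ∀ {h : (Fin D → ℝ) → ℝ}, Continuous h → Integrable h (uniformCubeMeasure D σ) :=
    fun hh => integrable_uniformCubeMeasure σ hh
  calc _ ≤ ∫ θ, ∑ k, (σ ^ 2 * partialDeriv k g (t • θ) ^ 2 + (g (t • θ) ^ 2 / (2 * D) +
        D * σ ^ 4 / 2 * partialDeriv k (partialDeriv k g) (t • θ) ^ 2))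
        ∂(uniformCubeMeasure D σ) := by
        refine integral_mono_ae (hint (by fun_prop)) (hint (by fun_prop)) ?_
        filter_upwards [ae_mem_Icc_uniformCubeMeasure D σ] with θ hθ
        refine Finset.sum_le_sum fun k _ => ?_
        have hk : θ k ^ 2 ≤ σ ^ 2 := sq_le_sq' (hθ.1 k) (hθ.2 k)
        rw [← mul_assoc]
        refine mul_sq_add_mul_le (mul_nonneg (sub_nonneg.2 hk) ht.1) ?_ hD0
        nlinarith [ht.1, ht.2, sq_nonneg (θ k)]
    _ = ∑ k, (σ ^ 2 * (∫ θ, partialDeriv k g (t • θ) ^ 2 ∂(uniformCubeMeasure D σ)) +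
        ((∫ θ, g (t • θ) ^ 2 ∂(uniformCubeMeasure D σ)) / (2 * D) + D * σ ^ 4 / 2 *
        ∫ θ, partialDeriv k (partialDeriv k g) (t • θ) ^ 2 ∂(uniformCubeMeasure D σ))) := by
        rw [integral_finsetSum _ fun k _ => hint (by fun_prop)]
        refine Finset.sum_congr rfl fun k _ => ?_
        rw [integral_add (hint (by fun_prop)) (hint (by fun_prop)),
          integral_add (hint (by fun_prop)) (hint (by fun_prop)),
          integral_const_mul, integral_const_mul, integral_div]
    _ = _ := by
        rw [Finset.sum_add_distrib, Finset.sum_add_distrib, Finset.sum_const, Finset.card_univ,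
          Fintype.card_fin, nsmul_eq_mul]
        congr 2
        field_simp

/-- Mean-squared bound for the Taylor remainder at every dilation `t • θ`, `t ∈ [0, 1]`. -/
theorem exists_integral_sq_taylorRem_dilation_le (m : ℕ) :
    ∃ c : ℝ, 0 < c ∧ ∀ D : ℕ, 1 ≤ D → ∀ M : ℝ, ∀ σ : ℝ, 0 < σ → (D : ℝ) * σ ^ 2 ≤ 1 →
      ∀ f : (Fin D → ℝ) → ℝ, ContDiff ℝ (⊤ : ℕ∞) f → (∀ α x, |multiDeriv α f x| ≤ M) →
      ∀ t ∈ Set.Icc (0 : ℝ) 1,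
        ∫ θ, taylorRem m f (t • θ) ^ 2 ∂(uniformCubeMeasure D σ) ≤
          c * M ^ 2 * ((D : ℝ) * σ ^ 2) ^ m := by
  induction m using Nat.strong_induction_on with
  | _ m ih =>
  rcases m with _ | m
  · refine ⟨1, one_pos, fun D _ M σ hσ _ f hf hM t _ => ?_⟩
    have := isProbabilityMeasure_uniformCubeMeasure D hσ
    have hb : ∀ θ : Fin D → ℝ, taylorRem 0 f (t • θ) ^ 2 ≤ M ^ 2 := fun θ => by
      have h := hM 0 (t • θ)
      rw [multiDeriv_zero] at h
      rw [taylorRem, taylorTrunc_zero, Pi.zero_apply, sub_zero]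
      exact sq_le_sq' (abs_le.1 h).1 (abs_le.1 h).2
    have hrc := (contDiff_taylorRem 0 hf).continuous
    refine (integral_mono (integrable_uniformCubeMeasure σ (by fun_prop))
      (integrable_const (M ^ 2)) hb).trans ?_
    simp
  · obtain ⟨a, ha, iha⟩ := ih m (by omega)
    obtain ⟨b, hb, ihb⟩ := ih (m - 1) (by omega)
    refine ⟨4 * (a + b / 2), by positivity, fun D hD M σ hσ hs f hf hM t ht => ?_⟩
    set s := (D : ℝ) * σ ^ 2 with hs_def
    have hs0 : 0 ≤ s := by positivity
    have hclosed : ∀ (k : Fin D) {u : (Fin D → ℝ) → ℝ}, ContDiff ℝ (⊤ : ℕ∞) u →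
        (∀ α x, |multiDeriv α u x| ≤ M) → ∀ α x, |multiDeriv α (partialDeriv k u) x| ≤ M := by
      intro k u hu hMu α x
      rw [multiDeriv_partialDeriv α k hu]
      exact hMu _ x
    have hpow : s ^ 2 * s ^ (m - 1) ≤ s ^ (m + 1) := by
      rw [← pow_add]
      exact pow_le_pow_of_le_one hs0 hs (by omega)
    have hg := contDiff_taylorRem (m + 1) hf
    have key := le_of_hasDerivAt_le_half_add (K := (a + b / 2) * M ^ 2 * s ^ (m + 1))
      (by positivity) ?_ (hasDerivAt_integral_sq_dilation σ hg) (fun r hr => ?_) ht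
    · linarith
    · simp [taylorRem, taylorTrunc_apply_zero]
    · refine (integral_sum_coord_mul_le hD hσ.le hg hr).trans ?_
      have h1 : ∑ k, (σ ^ 2 * ∫ θ, partialDeriv k (taylorRem (m + 1) f) (r • θ) ^ 2
          ∂(uniformCubeMeasure D σ)) ≤ a * M ^ 2 * s ^ (m + 1) := by
        refine (Finset.sum_le_card_nsmul Finset.univ _ (σ ^ 2 * (a * M ^ 2 * s ^ m))
          fun k _ => ?_).trans_eq ?_
        · rw [partialDeriv_taylorRem _ k hf, Nat.add_sub_cancel]
          gcongr
          exact iha D hD M σ hσ hs _ (contDiff_partialDeriv k hf) (hclosed k hf hM) r hr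
        · simp only [Finset.card_univ, Fintype.card_fin, nsmul_eq_mul, hs_def]
          ring
      have h2 : ∑ k, D * σ ^ 4 / 2 * ∫ θ, partialDeriv k (partialDeriv k (taylorRem (m + 1) f))
          (r • θ) ^ 2 ∂(uniformCubeMeasure D σ) ≤ b / 2 * M ^ 2 * s ^ (m + 1) := by
        refine (Finset.sum_le_card_nsmul Finset.univ _
          (D * σ ^ 4 / 2 * (b * M ^ 2 * s ^ (m - 1))) fun k _ => ?_).trans ?_
        · have hk := contDiff_partialDeriv k hf
          rw [partialDeriv_taylorRem _ k hf, Nat.add_sub_cancel, partialDeriv_taylorRem _ k hk]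
          gcongr
          exact ihb D hD M σ hσ hs _ (contDiff_partialDeriv k hk)
            (hclosed k hk (hclosed k hf hM)) r hr
        · calc _ = b / 2 * M ^ 2 * (s ^ 2 * s ^ (m - 1)) := by
                simp only [Finset.card_univ, Fintype.card_fin, nsmul_eq_mul, hs_def]
                ring
            _ ≤ _ := by gcongr
      linarith

/-- For every `m ≥ 1` there is a constant `c > 0` depending only on `m`
such that for all `D ≥ 1`, `M > 0`, `σ ∈ (0,1]` with `D·σ² ≤ 1`, every smooth `f` with all
iterated partial derivatives bounded by `M`, and `θ` with i.i.d. coordinates uniform on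
`[−σ,σ]`, the mean-squared Taylor truncation error satisfies
`E[(f(θ) − T_m f(θ))²] ≤ c·M²·D^m·σ^{2m}`. -/
theorem stmt10 (m : ℕ) (hm : 1 ≤ m) :
    ∃ c : ℝ, 0 < c ∧
      ∀ (D : ℕ), 1 ≤ D → ∀ M : ℝ, 0 < M → ∀ σ : ℝ, 0 < σ → σ ≤ 1 →
        (D : ℝ) * σ ^ 2 ≤ 1 →
        ∀ f : (Fin D → ℝ) → ℝ, ContDiff ℝ (⊤ : ℕ∞) f →
        (∀ (α : Fin D → ℕ) (x : Fin D → ℝ), |multiDeriv α f x| ≤ M) →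
        ∫ θ, (f θ - taylorTrunc D m f θ) ^ 2 ∂(uniformCubeMeasure D σ) ≤
          c * M ^ 2 * (D : ℝ) ^ m * σ ^ (2 * m) := by
  obtain ⟨c, hc, h⟩ := exists_integral_sq_taylorRem_dilation_le m
  refine ⟨c, hc, fun D hD M _ σ hσ _ hs f hf hM => ?_⟩
  have key := h D hD M σ hσ hs f hf hM 1 ⟨zero_le_one, le_rfl⟩
  simp only [one_smul, taylorRem] at key
  rwa [mul_pow, ← pow_mul, ← mul_assoc] at key
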